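/- Let 𝕂 be ℝ or ℂ, let X ⊆ 𝕂ⁿ with 0 ∈ X, and let f be analytic on an open neighborhood U of 0, not identically zero near 0, with order m, initial form f_m and next homogeneous component f_{m+1}, and suppose f vanishes identically on X ∩ U. Let u ∈ 𝕂ⁿ \ {0}. If w ∈ T²_{0,u}X, then f_m(u) = 0 and (1/2)⟨∇f_m(u), w⟩ + f_{m+1}(u) = 0. (In particular, the geometric directional second-order tangent set T²_{0,u}X is contained in the algebraic directional second-order tangent set T^{2,a}_{0,u}X.) -/

import Mathlib

open Filter Topology

/-- Admissible parameter values `t` for limits `t → 0`: nonzero, and positive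
when `𝕂 = ℝ` (detected by `RCLike.I = 0`). -/
def Adm {K : Type*} [RCLike K] (t : K) : Prop :=
  t ≠ 0 ∧ ((RCLike.I : K) = 0 → 0 < RCLike.re t)

/-- The geometric directional second-order tangent set `T²_{p,u} X`. -/
def secondTangentSet {K : Type*} [RCLike K] {n : ℕ}
    (X : Set (Fin n → K)) (p u : Fin n → K) : Set (Fin n → K) :=
  {w | ∃ t : ℕ → K, ∃ W : ℕ → (Fin n → K),
    (∀ k, Adm (t k)) ∧ Tendsto t atTop (𝓝 0) ∧ Tendsto W atTop (𝓝 w) ∧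
    ∀ k, p + t k • u + ((1 / 2 : K) * t k ^ 2) • W k ∈ X}

/-- The gradient vector `∇g(u) = (∂g/∂x₁(u), …, ∂g/∂xₙ(u))`. -/
noncomputable def grad {K : Type*} [RCLike K] {n : ℕ}
    (g : (Fin n → K) → K) (u : Fin n → K) : Fin n → K :=
  fun j => fderiv K g u (Pi.single j 1)

/-- The bilinear pairing `⟨a, b⟩ = ∑ i, aᵢ bᵢ`. -/
def pair {K : Type*} [RCLike K] {n : ℕ} (a b : Fin n → K) : K :=
  ∑ j, a j * b j

/-- Homogeneous components of a power series are continuously differentiable. -/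
lemma contDiff_homogeneous_component {K E : Type*} [RCLike K] [NormedAddCommGroup E]
    [NormedSpace K E] (P : FormalMultilinearSeries K E K) (i : ℕ) :
    ContDiff K 1 (fun x => P i (fun _ => x)) :=
  (P i).contDiff.comp (contDiff_pi.2 fun _ => contDiff_id)

/-- Along `t → 0` and `v → u` with `f (t • v) = 0`, the first two homogeneous components of `f`
cancel up to an error of order `t ^ 2`. -/
lemma isBigO_initial_forms {K E : Type*} [RCLike K] [NormedAddCommGroup E] [NormedSpace K E]
    {f : E → K} {P : FormalMultilinearSeries K E K} (hP : HasFPowerSeriesAt f P 0) {m : ℕ}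
    (horder : ∀ i < m, ∀ x, P i (fun _ => x) = 0) {t : ℕ → K} {v : ℕ → E} {u : E}
    (ht0 : ∀ k, t k ≠ 0) (ht : Tendsto t atTop (𝓝 0)) (hv : Tendsto v atTop (𝓝 u))
    (hf : ∀ᶠ k in atTop, f (t k • v k) = 0) :
    (fun k => P m (fun _ => v k) + t k * P (m + 1) (fun _ => v k)) =O[atTop]
      fun k => t k ^ 2 := by
  have hy : Tendsto (fun k => t k • v k) atTop (𝓝 0) := by simpa using ht.smul hv
  have hsum (k : ℕ) : P.partialSum (m + 2) (t k • v k) =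
      t k ^ m * (P m (fun _ => v k) + t k * P (m + 1) (fun _ => v k)) := by
    have hhom (i : ℕ) : P i (fun _ => t k • v k) = t k ^ i * P i (fun _ => v k) := by
      simpa using (P i).map_smul_univ (fun _ => t k) (fun _ => v k)
    rw [FormalMultilinearSeries.partialSum, Finset.sum_range_succ, Finset.sum_range_succ,
      Finset.sum_eq_zero fun i hi => horder i (Finset.mem_range.1 hi) _, hhom, hhom]
    ring
  have hO : (fun k => t k ^ m * (P m (fun _ => v k) + t k * P (m + 1) (fun _ => v k))) =O[atTop]
      fun k => ‖t k • v k‖ ^ (m + 2) := by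
    refine ((hP.isBigO_sub_partialSum_pow (m + 2)).comp_tendsto hy).neg_left.congr' ?_ .rfl
    filter_upwards [hf] with k hk
    simp [hk, hsum]
  have hvO : (fun k => ‖t k • v k‖ ^ (m + 2)) =O[atTop] fun k => t k ^ (m + 2) := by
    have h : (fun k => t k • v k) =O[atTop] fun k => t k := by
      simpa using (Asymptotics.isBigO_refl t atTop).smul (hv.isBigO_one K)
    exact h.norm_left.pow _
  refine ((Asymptotics.isBigO_refl (fun k => (t k ^ m)⁻¹) atTop).mul (hO.trans hvO)).congr
    (fun k => ?_) (fun k => ?_)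
  · exact inv_mul_cancel_left₀ (pow_ne_zero _ (ht0 k)) _
  · rw [pow_add, inv_mul_cancel_left₀ (pow_ne_zero _ (ht0 k))]

/-- Pairing with the gradient is the Fréchet derivative. -/
lemma pair_grad {K : Type*} [RCLike K] {n : ℕ} (g : (Fin n → K) → K) (u w : Fin n → K) :
    pair (grad g u) w = fderiv K g u w := by
  conv_rhs => rw [pi_eq_sum_univ' w]
  simp [pair, grad, mul_comm]

/-- If `f` is analytic near `0` and vanishes on `X ∩ U`, with order `m`,
initial form `f_m` and next homogeneous component `f_{m+1}`, then every
`w ∈ T²_{0,u} X` satisfies `f_m(u) = 0` and `(1/2)⟨∇f_m(u), w⟩ + f_{m+1}(u) = 0`;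
i.e. `T²_{0,u} X ⊆ T^{2,a}_{0,u} X`. -/
theorem stmt3 {K : Type*} [RCLike K] {n m : ℕ}
    (X : Set (Fin n → K)) (hX0 : (0 : Fin n → K) ∈ X)
    (U : Set (Fin n → K)) (hUopen : IsOpen U) (hU0 : (0 : Fin n → K) ∈ U)
    (f : (Fin n → K) → K) (hf : ∀ x ∈ U, AnalyticAt K f x)
    (hfvan : ∀ x ∈ X ∩ U, f x = 0)
    (P : FormalMultilinearSeries K (Fin n → K) K) (hP : HasFPowerSeriesAt f P 0)
    (fm fm1 : (Fin n → K) → K)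
    (hfm : fm = fun x => P m (fun _ => x))
    (hfm1 : fm1 = fun x => P (m + 1) (fun _ => x))
    (horder : ∀ i < m, ∀ x, P i (fun _ => x) = 0)
    (hfmne : fm ≠ 0)
    (u : Fin n → K) (hu : u ≠ 0)
    (w : Fin n → K) (hw : w ∈ secondTangentSet X 0 u) :
    fm u = 0 ∧ (1 / 2 : K) * pair (grad fm u) w + fm1 u = 0 := by
  obtain ⟨t, W, hAdm, ht, hW, hX⟩ := hw
  have ht0 (k : ℕ) : t k ≠ 0 := (hAdm k).1
  let d : ℕ → Fin n → K := fun k => t k • ((1 / 2 : K) • W k)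
  have hd : Tendsto d atTop (𝓝 0) := by simpa [d] using ht.smul (hW.const_smul (1 / 2 : K))
  have hv : Tendsto (fun k => u + d k) atTop (𝓝 u) := by
    simpa using tendsto_const_nhds.add hd
  have hy : Tendsto (fun k => t k • (u + d k)) atTop (𝓝 0) := by simpa using ht.smul hv
  have hyX (k : ℕ) : t k • (u + d k) ∈ X := by
    convert hX k using 1
    simp only [d, smul_add, smul_smul, zero_add]
    congr 2
    ring
  have hfy : ∀ᶠ k in atTop, f (t k • (u + d k)) = 0 := by
    filter_upwards [hy.eventually (hUopen.mem_nhds hU0)] with k hk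
    exact hfvan _ ⟨hyX k, hk⟩
  have hO : (fun k => fm (u + d k) + t k * fm1 (u + d k)) =O[atTop] fun k => t k ^ 2 := by
    subst hfm hfm1
    exact isBigO_initial_forms hP horder ht0 ht hv hfy
  have hfmC : ContDiff K 1 fm := hfm ▸ contDiff_homogeneous_component P m
  have hfm1C : ContDiff K 1 fm1 := hfm1 ▸ contDiff_homogeneous_component P (m + 1)
  have hlim : Tendsto (fun k => fm (u + d k)) atTop (𝓝 (fm u)) :=
    (hfmC.continuous.tendsto u).comp hv
  have hlim1 : Tendsto (fun k => fm1 (u + d k)) atTop (𝓝 (fm1 u)) :=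
    (hfm1C.continuous.tendsto u).comp hv
  have hfmu : fm u = 0 := by
    refine tendsto_nhds_unique (by simpa using hlim.add (ht.mul hlim1)) (hO.trans_tendsto ?_)
    simpa using ht.pow 2
  refine ⟨hfmu, ?_⟩
  have hquot : Tendsto (fun k => (t k)⁻¹ * (fm (u + d k) + t k * fm1 (u + d k)))
      atTop (𝓝 0) := by
    refine ((Asymptotics.isBigO_refl (fun k => (t k)⁻¹) atTop).mul hO).trans_tendsto ?_
    refine ht.congr fun k => ?_
    field_simp [ht0 k]
  have hderiv : Tendsto (fun k => (t k)⁻¹ • (fm (u + d k) - fm u)) atTop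
      (𝓝 (fderiv K fm u ((1 / 2 : K) • w))) := by
    refine ((hfmC.differentiable one_ne_zero u).hasFDerivAt.hasFDerivWithinAt
      (s := Set.univ)).lim hd (.of_forall fun _ => Set.mem_univ _) ?_
    refine (hW.const_smul (1 / 2 : K)).congr fun k => ?_
    exact (inv_smul_smul₀ (ht0 k) _).symm
  rw [pair_grad, ← smul_eq_mul (1 / 2 : K), ← map_smul]
  refine tendsto_nhds_unique (hderiv.add hlim1) (hquot.congr fun k => ?_)
  rw [hfmu, sub_zero, smul_eq_mul, mul_add, inv_mul_cancel_left₀ (ht0 k)]
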